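/- Let k be an even non-negative integer, let V = ℂ² carry the standard representation of Γ₁(2) via the inclusion Γ₁(2) ⊂ GL(2,ℂ), and let Γ₁(2) act diagonally on the k-fold tensor power V^{⊗k}, while the symmetric group S_k acts by permuting tensor factors. Then the subspace of Γ₁(2)-invariant vectors of V^{⊗k} is spanned by the S_k-orbit of the vector ω^{⊗ k/2}, where ω = e₁ ⊗ e₂ − e₂ ⊗ e₁ ∈ V ⊗ V and (e₁, e₂) is the standard basis of ℂ². -/

import Mathlib

open scoped MatrixGroups TensorProduct

/-- The matrix in `GL₂(ℂ)` (as a plain matrix) associated to an element of `Γ₁(2) ⊂ SL(2, ℤ)`. -/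
noncomputable def gammaOneTwoMatrix (g : CongruenceSubgroup.Gamma1 2) :
    Matrix (Fin 2) (Fin 2) ℂ :=
  ((g : SL(2, ℤ)) : Matrix (Fin 2) (Fin 2) ℤ).map (Int.castRingHom ℂ)

lemma gammaOneTwoMatrix_one : gammaOneTwoMatrix 1 = 1 := by
  simp [gammaOneTwoMatrix]

lemma gammaOneTwoMatrix_mul (g h : CongruenceSubgroup.Gamma1 2) :
    gammaOneTwoMatrix (g * h) = gammaOneTwoMatrix g * gammaOneTwoMatrix h := by
  simp only [gammaOneTwoMatrix]
  rw [show ((g * h : CongruenceSubgroup.Gamma1 2) : SL(2, ℤ))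
        = (g : SL(2, ℤ)) * (h : SL(2, ℤ)) from rfl,
    Matrix.SpecialLinearGroup.coe_mul, Matrix.map_mul]

/-- The standard representation of `Γ₁(2)` on `ℂ²`, obtained from the inclusion
`Γ₁(2) ⊂ SL(2, ℤ) ⊂ GL(2, ℂ)`, acting by matrix-vector multiplication. -/
noncomputable def stdRep : Representation ℂ (CongruenceSubgroup.Gamma1 2) (Fin 2 → ℂ) where
  toFun g := (gammaOneTwoMatrix g).mulVecLin
  map_one' := by
    show (gammaOneTwoMatrix 1).mulVecLin = _
    rw [gammaOneTwoMatrix_one, Matrix.mulVecLin_one]; rfl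
  map_mul' g h := by
    show (gammaOneTwoMatrix (g * h)).mulVecLin = _
    rw [gammaOneTwoMatrix_mul, Matrix.mulVecLin_mul]; rfl

/-- The diagonal action of `Γ₁(2)` on the `n`-fold tensor power `(ℂ²)^⊗n`. -/
noncomputable def tensorPowerRep (n : ℕ) :
    Representation ℂ (CongruenceSubgroup.Gamma1 2) (⨂[ℂ] _ : Fin n, (Fin 2 → ℂ)) where
  toFun g := PiTensorProduct.map (fun _ => stdRep g)
  map_one' := by
    show PiTensorProduct.map (fun _ : Fin n => stdRep 1) = 1
    rw [show (fun _ : Fin n => stdRep 1)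
          = fun _ : Fin n => (1 : (Fin 2 → ℂ) →ₗ[ℂ] (Fin 2 → ℂ)) by simp]
    exact PiTensorProduct.map_one
  map_mul' g h := by
    show PiTensorProduct.map (fun _ : Fin n => stdRep (g * h)) = _
    rw [show (fun _ : Fin n => stdRep (g * h))
          = (fun _ : Fin n => stdRep g) * (fun _ : Fin n => stdRep h) by
        funext i; simp [Pi.mul_apply]]
    exact PiTensorProduct.map_mul _ _

/-- The standard basis vectors `e₁, e₂` of `ℂ²`. -/
noncomputable def e₁ : Fin 2 → ℂ := Pi.single 0 1
noncomputable def e₂ : Fin 2 → ℂ := Pi.single 1 1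

/-- The element `ω^{⊗m} ∈ (ℂ²)^{⊗ 2m}`, where `ω = e₁ ⊗ e₂ - e₂ ⊗ e₁`: the tensor factors are
grouped in consecutive pairs `(2i, 2i+1)`, and expanding the product gives the sum over all
choices `s : Fin m → Bool`, the `i`-th pair contributing `e₁ ⊗ e₂` (sign `+1`) if `s i` and
`e₂ ⊗ e₁` (sign `-1`) otherwise. -/
noncomputable def omegaPow (m : ℕ) : ⨂[ℂ] _ : Fin (2 * m), (Fin 2 → ℂ) :=
  ∑ s : Fin m → Bool, (∏ i, if s i then (1 : ℂ) else -1) •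
    PiTensorProduct.tprod ℂ (fun j : Fin (2 * m) =>
      if s ⟨(j : ℕ) / 2, by have := j.isLt; omega⟩ then
        (if (j : ℕ) % 2 = 0 then e₁ else e₂)
      else
        (if (j : ℕ) % 2 = 0 then e₂ else e₁))

noncomputable def epsM : Matrix (Fin 2) (Fin 2) ℂ := !![0, 1; -1, 0]

noncomputable def actA {n : ℕ} (A : Matrix (Fin 2) (Fin 2) ℂ) (f : (Fin n → Fin 2) → ℂ) :
    (Fin n → Fin 2) → ℂ :=
  fun s => ∑ t : Fin n → Fin 2, (∏ k, A (s k) (t k)) * f t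

noncomputable def pairC {n : ℕ} (f g : (Fin n → Fin 2) → ℂ) : ℂ := ∑ s, star (f s) * g s

noncomputable def blk {n a b : ℕ} (e : (Fin a ⊕ Fin a) ⊕ Fin b ≃ Fin n) (w : Fin b → Fin 2 → ℂ) :
    (Fin n → Fin 2) → ℂ :=
  fun s => (∏ i, epsM (s (e (.inl (.inl i)))) (s (e (.inl (.inr i))))) * ∏ j, w j (s (e (.inr j)))

noncomputable def dd1 : Fin 2 → ℂ := ![1, 0]
noncomputable def dd2 : Fin 2 → ℂ := ![0, 1]

def QQ (n : ℕ) : Set ((Fin n → Fin 2) → ℂ) :=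
  {f | ∃ (a : ℕ) (e : (Fin a ⊕ Fin a) ⊕ Fin 0 ≃ Fin n), f = blk e (fun _ => dd1)}

def RR (n : ℕ) : Set ((Fin n → Fin 2) → ℂ) :=
  {f | ∃ (a b : ℕ) (e : (Fin a ⊕ Fin a) ⊕ Fin (b + 1) ≃ Fin n), f = blk e (fun _ => dd1)}

lemma actA_sub {n : ℕ} (A : Matrix (Fin 2) (Fin 2) ℂ) (f g : (Fin n → Fin 2) → ℂ) :
    actA A (f - g) = actA A f - actA A g := by
  funext s; simp [actA, mul_sub]

lemma actA_add {n : ℕ} (A : Matrix (Fin 2) (Fin 2) ℂ) (f g : (Fin n → Fin 2) → ℂ) :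
    actA A (f + g) = actA A f + actA A g := by
  funext s; simp [actA, mul_add, Finset.sum_add_distrib]

lemma actA_smul {n : ℕ} (A : Matrix (Fin 2) (Fin 2) ℂ) (c : ℂ) (f : (Fin n → Fin 2) → ℂ) :
    actA A (c • f) = c • actA A f := by
  funext s; simp only [actA, Pi.smul_apply, smul_eq_mul, Finset.mul_sum]
  exact Finset.sum_congr rfl fun _ _ => by ring

lemma actA_fix_span {n : ℕ} (A : Matrix (Fin 2) (Fin 2) ℂ) (S : Set ((Fin n → Fin 2) → ℂ))
    (h : ∀ f ∈ S, actA A f = f) {f : (Fin n → Fin 2) → ℂ} (hf : f ∈ Submodule.span ℂ S) :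
    actA A f = f := by
  induction hf using Submodule.span_induction with
  | mem x hx => exact h x hx
  | zero => funext s; simp [actA]
  | add x y _ _ hx hy => rw [actA_add, hx, hy]
  | smul c x _ hx => rw [actA_smul, hx]

lemma pairC_act {n : ℕ} (A B : Matrix (Fin 2) (Fin 2) ℂ) (h : ∀ i j, star (A i j) = B j i)
    (f g : (Fin n → Fin 2) → ℂ) :
    pairC f (actA A g) = pairC (actA B f) g := by
  simp only [pairC, actA, Finset.mul_sum, star_sum, Finset.sum_mul]
  rw [Finset.sum_comm]
  refine Finset.sum_congr rfl fun t _ => Finset.sum_congr rfl fun s _ => ?_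
  have : star (∏ k, B (t k) (s k)) = ∏ k, A (s k) (t k) := by
    rw [star_prod]
    exact Finset.prod_congr rfl fun k _ => by rw [← h, star_star]
  rw [star_mul, this]; ring

lemma pairC_self {n : ℕ} (f : (Fin n → Fin 2) → ℂ) (h : pairC f f = 0) : f = 0 := by
  have h1 : (∑ s, (Complex.normSq (f s) : ℝ)) = 0 := by
    have : ((∑ s, (Complex.normSq (f s) : ℝ) : ℝ) : ℂ) = 0 := by
      rw [← h, pairC]; push_cast
      exact Finset.sum_congr rfl fun s _ => Complex.normSq_eq_conj_mul_self
    exact_mod_cast this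
  rw [Finset.sum_eq_zero_iff_of_nonneg (fun _ _ => Complex.normSq_nonneg _)] at h1
  funext s
  exact Complex.normSq_eq_zero.1 (h1 s (Finset.mem_univ _))

lemma actA_blk {n a b : ℕ} (A : Matrix (Fin 2) (Fin 2) ℂ) (hA : A.det = 1)
    (e : (Fin a ⊕ Fin a) ⊕ Fin b ≃ Fin n) (w : Fin b → Fin 2 → ℂ) :
    actA A (blk e w) = blk e (fun j => A.mulVec (w j)) := by
  funext s
  simp only [actA, blk]
  let T : (Fin n → Fin 2) ≃ (Fin a → Fin 2 × Fin 2) × (Fin b → Fin 2) :=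
    (Equiv.arrowCongr e.symm (Equiv.refl _)).trans
      ((Equiv.sumArrowEquivProdArrow _ _ _).trans
        (Equiv.prodCongr ((Equiv.sumArrowEquivProdArrow _ _ _).trans
          (Equiv.arrowProdEquivProdArrow _ (fun _ => Fin 2) (fun _ => Fin 2)).symm) (Equiv.refl _)))
  have key : ∀ t : Fin n → Fin 2,
      (∏ k, A (s k) (t k)) * ((∏ i, epsM (t (e (.inl (.inl i)))) (t (e (.inl (.inr i))))) *
        ∏ j, w j (t (e (.inr j)))) =
      (∏ i, (A (s (e (.inl (.inl i)))) ((T t).1 i).1 * A (s (e (.inl (.inr i)))) ((T t).1 i).2 *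
        epsM ((T t).1 i).1 ((T t).1 i).2)) *
      ∏ j, (A (s (e (.inr j))) ((T t).2 j) * w j ((T t).2 j)) := by
    intro t
    rw [← e.prod_comp, Fintype.prod_sum_type, Fintype.prod_sum_type]
    simp only [Finset.prod_mul_distrib]
    simp only [T, Equiv.trans_apply, Equiv.sumArrowEquivProdArrow, Equiv.prodCongr_apply,
      Equiv.arrowProdEquivProdArrow, Equiv.arrowCongr, Equiv.coe_fn_mk, Equiv.coe_fn_symm_mk,
      Prod.map, Function.comp, Equiv.refl_apply, Equiv.symm_symm, Equiv.coe_refl, id]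
    ring
  rw [Finset.sum_congr rfl fun t _ => key t]
  rw [T.sum_comp (fun z : (Fin a → Fin 2 × Fin 2) × (Fin b → Fin 2) =>
    (∏ i, (A (s (e (.inl (.inl i)))) (z.1 i).1 * A (s (e (.inl (.inr i)))) (z.1 i).2 *
        epsM (z.1 i).1 (z.1 i).2)) *
      ∏ j, (A (s (e (.inr j))) (z.2 j) * w j (z.2 j)))]
  rw [Fintype.sum_prod_type]
  simp only [← Finset.mul_sum, ← Finset.sum_mul]
  rw [← Fintype.prod_sum (fun i (z : Fin 2 × Fin 2) => A (s (e (.inl (.inl i)))) z.1 *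
      A (s (e (.inl (.inr i)))) z.2 * epsM z.1 z.2),
    ← Fintype.prod_sum (fun j (z : Fin 2) => A (s (e (.inr j))) z * w j z)]
  congr 1
  refine Finset.prod_congr rfl fun i _ => ?_
  rw [Matrix.det_fin_two] at hA
  rw [Fintype.sum_prod_type]
  generalize s (e (.inl (.inl i))) = c
  generalize s (e (.inl (.inr i))) = d
  fin_cases c <;> fin_cases d <;> simp [epsM, Fin.sum_univ_two] <;>
    first | ring1 | linear_combination hA | linear_combination -hA

lemma actA_cons {n : ℕ} (A : Matrix (Fin 2) (Fin 2) ℂ) (f : (Fin (n+1) → Fin 2) → ℂ)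
    (c : Fin 2) (s : Fin n → Fin 2) :
    actA A f (Fin.cons c s) = A c 0 * actA A (fun t => f (Fin.cons 0 t)) s +
      A c 1 * actA A (fun t => f (Fin.cons 1 t)) s := by
  simp only [actA]
  rw [← (Fin.consEquiv (fun _ => Fin 2)).sum_comp, Fintype.sum_prod_type, Fin.sum_univ_two,
    Finset.mul_sum, Finset.mul_sum]
  simp [Fin.consEquiv, Fin.prod_univ_succ, mul_assoc]

noncomputable def uu : Matrix (Fin 2) (Fin 2) ℂ := !![1, 2; 0, 1]
noncomputable def ll : Matrix (Fin 2) (Fin 2) ℂ := !![1, 0; 2, 1]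

lemma uu_det : uu.det = 1 := by simp [uu, Matrix.det_fin_two]
lemma ll_det : ll.det = 1 := by simp [ll, Matrix.det_fin_two]
lemma uu_star : ∀ i j, star (uu i j) = ll j i := by
  intro i j; fin_cases i <;> fin_cases j <;> simp [uu, ll]
lemma uu_dd1 : uu.mulVec dd1 = dd1 := by
  ext i; fin_cases i <;> simp [uu, dd1, Matrix.mulVec, dotProduct]
lemma uu_dd2 : uu.mulVec dd2 = dd2 + (2:ℂ) • dd1 := by
  ext i; fin_cases i <;> simp [uu, dd1, dd2, Matrix.mulVec, dotProduct]

lemma QQ_fix {n : ℕ} (A : Matrix (Fin 2) (Fin 2) ℂ) (hA : A.det = 1)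
    {f : (Fin n → Fin 2) → ℂ} (hf : f ∈ Submodule.span ℂ (QQ n)) : actA A f = f := by
  refine actA_fix_span A _ ?_ hf
  rintro _ ⟨a, e, rfl⟩
  rw [actA_blk A hA]
  congr 1
  funext j; exact j.elim0

lemma PP_fix {n : ℕ} {f : (Fin n → Fin 2) → ℂ} (hf : f ∈ Submodule.span ℂ (QQ n ∪ RR n)) :
    actA uu f = f := by
  refine actA_fix_span uu _ ?_ hf
  rintro _ (⟨a, e, rfl⟩ | ⟨a, b, e, rfl⟩) <;> rw [actA_blk uu uu_det, uu_dd1]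

lemma blk_mem {n a b : ℕ} (e : (Fin a ⊕ Fin a) ⊕ Fin b ≃ Fin n) :
    blk e (fun _ => dd1) ∈ QQ n ∪ RR n := by
  cases b with
  | zero => exact Or.inl ⟨a, e, rfl⟩
  | succ b => exact Or.inr ⟨a, b, e, rfl⟩

/-- add a new single -/
lemma addSingle {n : ℕ} {k : (Fin n → Fin 2) → ℂ} (hk : k ∈ Submodule.span ℂ (QQ n ∪ RR n)) :
    (fun s : Fin (n+1) → Fin 2 => dd1 (s 0) * k (fun i => s i.succ)) ∈
      Submodule.span ℂ (QQ (n+1) ∪ RR (n+1)) := by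
  induction hk using Submodule.span_induction with
  | mem x hx =>
    have : ∃ (a b : ℕ) (e : (Fin a ⊕ Fin a) ⊕ Fin b ≃ Fin n), x = blk e (fun _ => dd1) := by
      rcases hx with ⟨a, e, h⟩ | ⟨a, b, e, h⟩
      exacts [⟨a, 0, e, h⟩, ⟨a, b+1, e, h⟩]
    obtain ⟨a, b, e, rfl⟩ := this
    let F : (Fin a ⊕ Fin a) ⊕ Fin (b+1) → Fin (n+1) :=
      Sum.elim (fun z => (e (.inl z)).succ) (Fin.cons 0 (fun j => (e (.inr j)).succ))
    have hc : Fintype.card ((Fin a ⊕ Fin a) ⊕ Fin (b+1)) = Fintype.card (Fin (n+1)) := by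
      have := Fintype.card_congr e
      simp at this ⊢
      omega
    have hF : Function.Bijective F := by
      refine (Fintype.bijective_iff_surjective_and_card F).2 ⟨?_, hc⟩
      · intro y
        induction y using Fin.cases with
        | zero => exact ⟨.inr 0, by simp [F]⟩
        | succ y =>
          obtain ⟨z, rfl⟩ := e.surjective y
          rcases z with z | z
          · exact ⟨.inl z, by simp [F]⟩
          · exact ⟨.inr z.succ, by simp [F]⟩
    apply Submodule.subset_span
    convert blk_mem (Equiv.ofBijective F hF) using 1
    funext s
    simp [blk, F, Fin.prod_univ_succ]
    ring
  | zero => simp; exact Submodule.zero_mem _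
  | add x y _ _ hx hy =>
    convert Submodule.add_mem _ hx hy using 1
    funext s; simp [mul_add]
  | smul c x _ hx =>
    convert Submodule.smul_mem _ c hx using 1
    funext s; simp; ring

lemma addPair {n : ℕ} {k : (Fin n → Fin 2) → ℂ} (hk : k ∈ Submodule.span ℂ (RR n)) :
    ∃ g ∈ Submodule.span ℂ (QQ (n+1) ∪ RR (n+1)), ∀ s, g (Fin.cons 1 s) = k s := by
  induction hk using Submodule.span_induction with
  | mem x hx =>
    obtain ⟨a, b, e, rfl⟩ := hx
    let F : (Fin (a+1) ⊕ Fin (a+1)) ⊕ Fin b → Fin (n+1) :=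
      Sum.elim (Sum.elim (Fin.cons (e (.inr 0)).succ (fun i => (e (.inl (.inl i))).succ))
        (Fin.cons 0 (fun i => (e (.inl (.inr i))).succ))) (fun j => (e (.inr j.succ)).succ)
    have hF : Function.Surjective F := by
      intro y
      induction y using Fin.cases with
      | zero => exact ⟨.inl (.inr 0), by simp [F]⟩
      | succ y =>
        obtain ⟨z, rfl⟩ := e.surjective y
        rcases z with (z | z) | z
        · exact ⟨.inl (.inl z.succ), by simp [F]⟩
        · exact ⟨.inl (.inr z.succ), by simp [F]⟩
        · induction z using Fin.cases with
          | zero => exact ⟨.inl (.inl 0), by simp [F]⟩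
          | succ z => exact ⟨.inr z, by simp [F]⟩
    have hc : Fintype.card ((Fin (a+1) ⊕ Fin (a+1)) ⊕ Fin b) = Fintype.card (Fin (n+1)) := by
      have := Fintype.card_congr e
      simp at this ⊢
      omega
    have hB : Function.Bijective F := (Fintype.bijective_iff_surjective_and_card F).2 ⟨hF, hc⟩
    refine ⟨_, Submodule.subset_span (blk_mem (Equiv.ofBijective F hB)), fun s => ?_⟩
    have h1 : ∀ c, epsM c 1 = dd1 c := by
      intro c; fin_cases c <;> simp [epsM, dd1]
    simp [blk, F, Fin.prod_univ_succ, h1]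
    ring
  | zero => exact ⟨0, Submodule.zero_mem _, fun _ => rfl⟩
  | add x y _ _ hx hy =>
    obtain ⟨g, hg, h⟩ := hx
    obtain ⟨g', hg', h'⟩ := hy
    exact ⟨g + g', Submodule.add_mem _ hg hg', fun s => by simp [h, h']⟩
  | smul c x _ hx =>
    obtain ⟨g, hg, h⟩ := hx
    exact ⟨c • g, Submodule.smul_mem _ c hg, fun s => by simp [h]⟩

lemma pairC_sub_right {n : ℕ} (f g h : (Fin n → Fin 2) → ℂ) :
    pairC f (g - h) = pairC f g - pairC f h := by
  simp [pairC, mul_sub]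

lemma pairC_smul_right {n : ℕ} (c : ℂ) (f g : (Fin n → Fin 2) → ℂ) :
    pairC f (c • g) = c * pairC f g := by
  simp only [pairC, Finset.mul_sum, Pi.smul_apply, smul_eq_mul]
  exact Finset.sum_congr rfl fun _ _ => by ring

/-- an `ll`-fixed vector is orthogonal to the image of `uu - 1` -/
lemma pairC_img {n : ℕ} (f g : (Fin n → Fin 2) → ℂ) (hf : actA ll f = f) :
    pairC f (actA uu g - g) = 0 := by
  rw [pairC_sub_right, pairC_act uu ll uu_star, hf, sub_self]

lemma mem_PP (n : ℕ) : ∀ f : (Fin n → Fin 2) → ℂ, actA uu f = f →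
    f ∈ Submodule.span ℂ (QQ n ∪ RR n) := by
  induction n with
  | zero =>
    intro f _
    let e : (Fin 0 ⊕ Fin 0) ⊕ Fin 0 ≃ Fin 0 := Equiv.equivOfIsEmpty _ _
    have : f = f Fin.elim0 • blk e (fun _ => dd1) := by
      funext s
      simp [blk, Subsingleton.elim s Fin.elim0]
    rw [this]
    exact Submodule.smul_mem _ _ (Submodule.subset_span (blk_mem e))
  | succ n ih =>
    have dec : ∀ f : (Fin (n+1) → Fin 2) → ℂ, actA uu f = f →
        actA uu (fun t => f (Fin.cons 1 t)) = (fun t => f (Fin.cons 1 t)) ∧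
        actA uu (fun t => f (Fin.cons 0 t)) - (fun t => f (Fin.cons 0 t)) =
          (-2 : ℂ) • (fun t => f (Fin.cons 1 t)) := by
      intro f hf
      have h1 : actA uu (fun t => f (Fin.cons 1 t)) = (fun t => f (Fin.cons 1 t)) := by
        funext s
        have := actA_cons uu f 1 s
        rw [hf] at this
        simp [uu] at this ⊢
        exact this.symm
      refine ⟨h1, ?_⟩
      funext s
      have := actA_cons uu f 0 s
      rw [hf, h1] at this
      simp [uu] at this ⊢
      rw [this]; ring
    intro f hf
    obtain ⟨h2, -⟩ := dec f hf
    have hm := ih _ h2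
    rw [Submodule.span_union, Submodule.mem_sup] at hm
    obtain ⟨φ, hφ, ψ, hψ, hs⟩ := hm
    obtain ⟨g, hg, hgψ⟩ := addPair hψ
    have hfg : actA uu (f - g) = f - g := by rw [actA_sub, hf, PP_fix hg]
    obtain ⟨-, h3⟩ := dec _ hfg
    have hφ' : (fun t => (f - g) (Fin.cons 1 t)) = φ := by
      funext t
      have := congrFun hs t
      simp only [Pi.add_apply] at this
      simp [hgψ, ← this]
    rw [hφ'] at h3
    have hφ0 : φ = 0 := by
      apply pairC_self
      have := pairC_img φ (fun t => (f - g) (Fin.cons 0 t)) (QQ_fix ll ll_det hφ)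
      rw [h3, pairC_smul_right] at this
      simpa using this
    rw [hφ0, smul_zero, sub_eq_zero] at h3
    have hk := addSingle (ih _ h3)
    have : f = g + (fun s : Fin (n+1) → Fin 2 => dd1 (s 0) *
        (fun t => (f - g) (Fin.cons 0 t)) (fun i => s i.succ)) := by
      funext s
      obtain ⟨c, t, rfl⟩ : ∃ c t, s = Fin.cons c t := ⟨s 0, fun i => s i.succ, (Fin.cons_self_tail s).symm⟩
      have h4 := congrFun hφ' t
      rw [hφ0] at h4
      simp only [Pi.sub_apply, Pi.zero_apply, sub_eq_zero] at h4
      have hc : c = 0 ∨ c = 1 := by fin_cases c <;> simp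
      rcases hc with rfl | rfl
      · simp [dd1]
      · simp [dd1, h4]
    rw [this]
    exact Submodule.add_mem _ hg hk

lemma pairC_RR {n : ℕ} (f : (Fin n → Fin 2) → ℂ) (hf : actA ll f = f) {ψ : (Fin n → Fin 2) → ℂ}
    (hψ : ψ ∈ Submodule.span ℂ (RR n)) : pairC f ψ = 0 := by
  induction hψ using Submodule.span_induction with
  | mem x hx =>
    obtain ⟨a, b, e, rfl⟩ := hx
    have := pairC_img f (blk e (Fin.cons dd2 (fun _ => dd1))) hf
    have h2 : actA uu (blk e (Fin.cons dd2 (fun _ => dd1))) - blk e (Fin.cons dd2 (fun _ => dd1))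
        = (2 : ℂ) • blk e (fun _ => dd1) := by
      rw [actA_blk uu uu_det]
      funext s
      simp only [blk, Fin.prod_univ_succ, Fin.cons_zero, Fin.cons_succ, uu_dd1, uu_dd2,
        Pi.sub_apply, Pi.smul_apply, Pi.add_apply, smul_eq_mul]
      ring
    rw [h2, pairC_smul_right] at this
    simpa using this
  | zero => simp [pairC]
  | add x y _ _ hx hy =>
    have : pairC f (x + y) = pairC f x + pairC f y := by
      simp [pairC, mul_add, Finset.sum_add_distrib]
    rw [this, hx, hy, add_zero]
  | smul c x _ hx => rw [pairC_smul_right, hx, mul_zero]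

lemma mem_QQ {n : ℕ} (f : (Fin n → Fin 2) → ℂ) (hu : actA uu f = f) (hl : actA ll f = f) :
    f ∈ Submodule.span ℂ (QQ n) := by
  have hm := mem_PP n f hu
  rw [Submodule.span_union, Submodule.mem_sup] at hm
  obtain ⟨φ, hφ, ψ, hψ, hs⟩ := hm
  have hψ' : ψ = f - φ := by rw [← hs]; simp
  have hl' : actA ll ψ = ψ := by rw [hψ', actA_sub, hl, QQ_fix ll ll_det hφ]
  have : ψ = 0 := pairC_self _ (pairC_RR ψ hl' hψ)
  rw [← hs, this, add_zero]
  exact hφ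

noncomputable def tB (n : ℕ) : Module.Basis (Fin n → Fin 2) ℂ (⨂[ℂ] _ : Fin n, (Fin 2 → ℂ)) :=
  Basis.piTensorProduct (fun _ : Fin n => Pi.basisFun ℂ (Fin 2))

lemma tB_tprod {n : ℕ} (w : Fin n → Fin 2 → ℂ) (s : Fin n → Fin 2) :
    (tB n).equivFun (PiTensorProduct.tprod ℂ w) s = ∏ i, w i (s i) := by
  rw [Module.Basis.equivFun_apply, tB, Basis.piTensorProduct_repr_tprod_apply]
  simp

lemma tB_map {n : ℕ} (M : Matrix (Fin 2) (Fin 2) ℂ) (x : ⨂[ℂ] _ : Fin n, (Fin 2 → ℂ)) :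
    (tB n).equivFun (PiTensorProduct.map (fun _ => M.mulVecLin) x) =
      actA M ((tB n).equivFun x) := by
  induction x using PiTensorProduct.induction_on with
  | smul_tprod r w =>
    rw [map_smul, map_smul, map_smul, actA_smul, PiTensorProduct.map_tprod]
    congr 1
    funext s
    rw [tB_tprod]
    simp only [actA, tB_tprod, ← Finset.prod_mul_distrib]
    rw [← Fintype.prod_sum (fun k d => M (s k) d * w k d)]
    rfl
  | add x y hx hy => rw [map_add, map_add, map_add, actA_add, hx, hy]

lemma tB_reindex {n : ℕ} (σ : Equiv.Perm (Fin n)) (x : ⨂[ℂ] _ : Fin n, (Fin 2 → ℂ))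
    (s : Fin n → Fin 2) :
    (tB n).equivFun (PiTensorProduct.reindex ℂ (fun _ => (Fin 2 → ℂ)) σ x) s =
      (tB n).equivFun x (s ∘ σ) := by
  induction x using PiTensorProduct.induction_on with
  | smul_tprod r w =>
    rw [map_smul, map_smul, map_smul, PiTensorProduct.reindex_tprod]
    simp only [Pi.smul_apply, tB_tprod]
    rw [← Equiv.prod_comp σ]
    simp
  | add x y hx hy =>
    rw [map_add, map_add, map_add, Pi.add_apply, Pi.add_apply, hx, hy]

lemma e0_bij (m : ℕ) : Function.Bijective (Sum.elim (Sum.elim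
    (fun i : Fin m => (⟨2 * i, by omega⟩ : Fin (2 * m)))
    (fun i : Fin m => (⟨2 * i + 1, by omega⟩ : Fin (2 * m)))) (Fin.elim0 : Fin 0 → _)) := by
  rw [Fintype.bijective_iff_surjective_and_card]
  constructor
  · intro j
    rcases Nat.mod_two_eq_zero_or_one j with h | h
    · exact ⟨.inl (.inl ⟨j / 2, by omega⟩), by apply Fin.ext; simp; omega⟩
    · exact ⟨.inl (.inr ⟨j / 2, by omega⟩), by apply Fin.ext; simp; omega⟩
  · simp; omega

noncomputable def e0 (m : ℕ) : (Fin m ⊕ Fin m) ⊕ Fin 0 ≃ Fin (2 * m) :=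
  Equiv.ofBijective _ (e0_bij m)

lemma e0_inl (m : ℕ) (i : Fin m) : ((e0 m (.inl (.inl i)) : Fin (2 * m)) : ℕ) = 2 * i := by
  simp [e0]

lemma e0_inr (m : ℕ) (i : Fin m) : ((e0 m (.inl (.inr i)) : Fin (2 * m)) : ℕ) = 2 * i + 1 := by
  simp [e0]

lemma tB_omega (m : ℕ) : (tB (2 * m)).equivFun (omegaPow m) = blk (e0 m) (fun _ => dd1) := by
  funext s
  rw [omegaPow, map_sum, Finset.sum_apply]
  simp only [map_smul, Pi.smul_apply, tB_tprod, smul_eq_mul]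
  have key : ∀ r : Fin m → Bool, (∏ i, if r i then (1 : ℂ) else -1) *
      (∏ j : Fin (2 * m), (if r ⟨(j : ℕ) / 2, by have := j.isLt; omega⟩ then
        (if (j : ℕ) % 2 = 0 then e₁ else e₂)
      else
        (if (j : ℕ) % 2 = 0 then e₂ else e₁)) (s j)) =
      ∏ i, (if r i then e₁ (s (e0 m (.inl (.inl i)))) * e₂ (s (e0 m (.inl (.inr i))))
        else - (e₂ (s (e0 m (.inl (.inl i)))) * e₁ (s (e0 m (.inl (.inr i)))))) := by
    intro r
    rw [← (e0 m).prod_comp, Fintype.prod_sum_type, Fintype.prod_sum_type]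
    simp only [Finset.univ_eq_empty, Finset.prod_empty, mul_one, ← Finset.prod_mul_distrib]
    refine Finset.prod_congr rfl fun i _ => ?_
    have h1 : (⟨((e0 m (.inl (.inl i)) : Fin (2 * m)) : ℕ) / 2, by omega⟩ : Fin m) = i := by
      apply Fin.ext; simp [e0_inl]
    have h2 : (⟨((e0 m (.inl (.inr i)) : Fin (2 * m)) : ℕ) / 2, by omega⟩ : Fin m) = i := by
      apply Fin.ext; simp [e0_inr]; omega
    have h3 : ((e0 m (.inl (.inl i)) : Fin (2 * m)) : ℕ) % 2 = 0 := by rw [e0_inl]; omega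
    have h4 : ¬ ((e0 m (.inl (.inr i)) : Fin (2 * m)) : ℕ) % 2 = 0 := by rw [e0_inr]; omega
    rw [h1, h2]
    simp only [h3, h4, if_true, if_false]
    by_cases h : r i <;> simp [h]
  rw [Finset.sum_congr rfl fun r _ => key r]
  rw [← Fintype.prod_sum (fun (i : Fin m) (c : Bool) =>
    (if c then e₁ (s (e0 m (.inl (.inl i)))) * e₂ (s (e0 m (.inl (.inr i))))
        else - (e₂ (s (e0 m (.inl (.inl i)))) * e₁ (s (e0 m (.inl (.inr i)))))))]
  simp only [blk, Finset.univ_eq_empty, Finset.prod_empty, mul_one]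
  refine Finset.prod_congr rfl fun i _ => ?_
  generalize s (e0 m (.inl (.inl i))) = c
  generalize s (e0 m (.inl (.inr i))) = d
  fin_cases c <;> fin_cases d <;> simp [epsM, e₁, e₂]

lemma tB_orbit (m : ℕ) (σ : Equiv.Perm (Fin (2 * m))) :
    (tB (2 * m)).equivFun (PiTensorProduct.reindex ℂ (fun _ => (Fin 2 → ℂ)) σ (omegaPow m)) =
      blk ((e0 m).trans σ) (fun _ => dd1) := by
  funext s
  rw [tB_reindex, tB_omega]
  rfl

lemma QQ_orbit (m : ℕ) : QQ (2 * m) = (tB (2 * m)).equivFun '' {x | ∃ σ : Equiv.Perm (Fin (2 * m)),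
        x = PiTensorProduct.reindex ℂ (fun _ => (Fin 2 → ℂ)) σ (omegaPow m)} := by
  ext f
  constructor
  · rintro ⟨a, e, rfl⟩
    obtain rfl : a = m := by
      have := Fintype.card_congr e
      simp at this
      omega
    refine ⟨_, ⟨(e0 a).symm.trans e, rfl⟩, ?_⟩
    rw [tB_orbit]
    congr 1
    ext x; simp
  · rintro ⟨_, ⟨σ, rfl⟩, rfl⟩
    exact ⟨m, _, tB_orbit m σ⟩

lemma span_iff (m : ℕ) (x : ⨂[ℂ] _ : Fin (2 * m), (Fin 2 → ℂ)) :
    x ∈ Submodule.span ℂ {x | ∃ σ : Equiv.Perm (Fin (2 * m)),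
        x = PiTensorProduct.reindex ℂ (fun _ => (Fin 2 → ℂ)) σ (omegaPow m)} ↔
    (tB (2 * m)).equivFun x ∈ Submodule.span ℂ (QQ (2 * m)) := by
  rw [QQ_orbit]
  have := Submodule.map_span (tB (2 * m)).equivFun.toLinearMap
    {x | ∃ σ : Equiv.Perm (Fin (2 * m)),
        x = PiTensorProduct.reindex ℂ (fun _ => (Fin 2 → ℂ)) σ (omegaPow m)}
  simp only [LinearEquiv.coe_coe] at this
  rw [← this]
  constructor
  · exact fun h => ⟨x, h, rfl⟩
  · rintro ⟨y, hy, h⟩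
    rwa [← (tB (2 * m)).equivFun.injective h]

lemma gdet (g : CongruenceSubgroup.Gamma1 2) : (gammaOneTwoMatrix g).det = 1 := by
  rw [gammaOneTwoMatrix, ← RingHom.mapMatrix_apply, ← RingHom.map_det,
    Matrix.SpecialLinearGroup.det_coe, map_one]

lemma exists_uu : ∃ g, gammaOneTwoMatrix g = uu := by
  refine ⟨⟨⟨!![1, 2; 0, 1], by simp [Matrix.det_fin_two]⟩, ?_⟩, ?_⟩
  · refine (CongruenceSubgroup.Gamma1_mem _ _).2 ⟨?_, ?_, ?_⟩ <;> simp
  · ext i j; fin_cases i <;> fin_cases j <;> simp [gammaOneTwoMatrix, uu]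

lemma exists_ll : ∃ g, gammaOneTwoMatrix g = ll := by
  refine ⟨⟨⟨!![1, 0; 2, 1], by simp [Matrix.det_fin_two]⟩, ?_⟩, ?_⟩
  · refine (CongruenceSubgroup.Gamma1_mem _ _).2 ⟨?_, ?_, ?_⟩ <;> simp; rfl
  · ext i j; fin_cases i <;> fin_cases j <;> simp [gammaOneTwoMatrix, ll]

lemma rep_eq (n : ℕ) (g : CongruenceSubgroup.Gamma1 2) (x : ⨂[ℂ] _ : Fin n, (Fin 2 → ℂ)) :
    tensorPowerRep n g x = x ↔
      actA (gammaOneTwoMatrix g) ((tB n).equivFun x) = (tB n).equivFun x := by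
  rw [← tB_map, (tB n).equivFun.injective.eq_iff]
  rfl

/-- For an even number `k = 2m`, the subspace of `Γ₁(2)`-invariant vectors of
the `k`-fold tensor power `(ℂ²)^{⊗k}` of the standard representation is spanned by the orbit of
`ω^{⊗ k/2}` under the action of the symmetric group `S_k` permuting the tensor factors. -/
theorem invariants_tensorPowerRep_eq_span_permOrbit_omegaPow (m : ℕ) :
    (tensorPowerRep (2 * m)).invariants =
      Submodule.span ℂ {x | ∃ σ : Equiv.Perm (Fin (2 * m)),
        x = PiTensorProduct.reindex ℂ (fun _ => (Fin 2 → ℂ)) σ (omegaPow m)} := by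
  ext x
  rw [span_iff, Representation.mem_invariants]
  constructor
  · intro h
    obtain ⟨g, hg⟩ := exists_uu
    obtain ⟨g', hg'⟩ := exists_ll
    have h1 := (rep_eq _ g x).1 (h g)
    have h2 := (rep_eq _ g' x).1 (h g')
    rw [hg] at h1
    rw [hg'] at h2
    exact mem_QQ _ h1 h2
  · intro h g
    rw [rep_eq]
    exact QQ_fix _ (gdet g) h
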